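/- Let t_1 ∈ F^×, set t = diag(t_1, 1, t_1^{-1}), and let h be the corresponding endomorphism of sl_3(F). Let s ∈ F satisfy s² = t_1. If the eight elements 1, −1, −t_1, −t_1^{-1}, s, −s, s^{-1}, −s^{-1} are pairwise distinct, then h has simple spectrum on sl_3(F), i.e., h has eight pairwise distinct eigenvalues. -/

import Mathlib

noncomputable section

/-- `sl₃(F)`: the space of traceless `3 × 3` matrices over `F`. -/
def sl3 (F : Type*) [Field F] : Submodule F (Matrix (Fin 3) (Fin 3) F) :=
  LinearMap.ker (Matrix.traceLinearMap (Fin 3) F F)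

/-- The matrix `n_w` with rows `(0,1,0)`, `(1,0,0)`, `(0,0,-1)`. -/
def nw (F : Type*) [Field F] : Matrix (Fin 3) (Fin 3) F :=
  !![0, 1, 0; 1, 0, 0; 0, 0, -1]

/-- The endomorphism `X ↦ -((n_w t) X (n_w t)⁻¹)ᵀ` of the space of `3 × 3` matrices,
where `t = diag(t₁, t₂, t₃)`. -/
def hFull (F : Type*) [Field F] (t₁ t₂ t₃ : F) :
    Module.End F (Matrix (Fin 3) (Fin 3) F) :=
  -((Matrix.transposeLinearEquiv (Fin 3) (Fin 3) F F).toLinearMap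
      ∘ₗ LinearMap.mulRight F (nw F * Matrix.diagonal ![t₁, t₂, t₃])⁻¹
      ∘ₗ LinearMap.mulLeft F (nw F * Matrix.diagonal ![t₁, t₂, t₃]))

/-- A diagonalizable endomorphism has *simple spectrum* if it is diagonalizable and every
eigenvalue has (geometric) multiplicity 1. -/
def HasSimpleSpectrum {F V : Type*} [Field F] [AddCommGroup V] [Module F V]
    (f : Module.End F V) : Prop :=
  (⨆ μ : F, f.eigenspace μ) = ⊤ ∧ ∀ μ : F, Module.finrank F (f.eigenspace μ) ≤ 1

/-- The space `sl₃(F)` has dimension `8`. -/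
theorem finrank_sl3 (F : Type*) [Field F] : Module.finrank F (sl3 F) = 8 := by
  have hsurj : Function.Surjective (Matrix.traceLinearMap (Fin 3) F F) := fun x =>
    ⟨!![x, 0, 0; 0, 0, 0; 0, 0, 0], by simp [Matrix.trace_fin_three]⟩
  have h := LinearMap.finrank_range_add_finrank_ker (Matrix.traceLinearMap (Fin 3) F F)
  rw [LinearMap.range_eq_top.2 hsurj, finrank_top, Module.finrank_self,
    Module.finrank_matrix] at h
  simp only [Fintype.card_fin, Module.finrank_self] at h
  change Module.finrank F (LinearMap.ker (Matrix.traceLinearMap (Fin 3) F F)) = 8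
  omega

/-- Membership in `sl₃(F)` in terms of the diagonal entries. -/
theorem mem_sl3_iff {F : Type*} [Field F] (X : Matrix (Fin 3) (Fin 3) F) :
    X ∈ sl3 F ↔ X 0 0 + X 1 1 + X 2 2 = 0 := by
  simp [sl3, Matrix.trace_fin_three]

/-- An endomorphism with a basis of eigenvectors for pairwise distinct eigenvalues has simple
spectrum. -/
theorem hasSimpleSpectrum_of_basis {F V ι : Type*} [Field F] [AddCommGroup V] [Module F V]
    (f : Module.End F V) (b : Module.Basis ι F V) (μ : ι → F) (hμ : Function.Injective μ)
    (hb : ∀ i, f (b i) = μ i • b i) : HasSimpleSpectrum f := by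
  refine ⟨?_, fun ν => ?_⟩
  · rw [eq_top_iff, ← b.span_eq, Submodule.span_le]
    rintro _ ⟨i, rfl⟩
    exact Submodule.mem_iSup_of_mem (μ i) (Module.End.mem_eigenspace_iff.2 (hb i))
  · have hcoord (i : ι) (w : V) : b.repr (f w) i = μ i * b.repr w i := by
      have : (b.coord i) ∘ₗ f = μ i • b.coord i := by
        refine b.ext fun j => ?_
        by_cases hij : j = i
        · subst hij
          simp [hb]
        · simp [hb, hij]
      simpa using LinearMap.congr_fun this w
    have hzero (w : V) (hw : w ∈ f.eigenspace ν) (i : ι) (hi : μ i ≠ ν) : b.repr w i = 0 := by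
      have h := hcoord i w
      rw [Module.End.mem_eigenspace_iff.1 hw, map_smul, Finsupp.smul_apply, smul_eq_mul] at h
      by_contra hne
      exact hi (mul_right_cancel₀ hne h).symm
    by_cases hν : ∃ i, μ i = ν
    · obtain ⟨i, rfl⟩ := hν
      refine finrank_le_one ⟨b i, Module.End.mem_eigenspace_iff.2 (hb i)⟩ fun w =>
        ⟨b.repr w i, Subtype.ext (b.ext_elem fun j => ?_)⟩
      by_cases hij : i = j
      · subst hij
        simp
      · simp [hij, hzero w w.2 j fun h => hij (hμ h).symm]
    · refine finrank_le_one 0 fun w => ⟨0, Subtype.ext (b.ext_elem fun j => ?_)⟩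
      simp [hzero w w.2 j fun h => hν ⟨j, h⟩]

/-- An endomorphism of an `n`-dimensional space with `n` distinct eigenvalues has simple
spectrum. -/
theorem hasSimpleSpectrum_of_eigenvectors {F V ι : Type*} [Field F] [AddCommGroup V] [Module F V]
    [Fintype ι] [Nonempty ι] (f : Module.End F V) (μ : ι → F) (hμ : Function.Injective μ)
    (v : ι → V) (hv : ∀ i, f.HasEigenvector (μ i) (v i))
    (hcard : Fintype.card ι = Module.finrank F V) : HasSimpleSpectrum f := by
  have hli := Module.End.eigenvectors_linearIndependent' f μ hμ v hv
  refine hasSimpleSpectrum_of_basis f (basisOfLinearIndependentOfCardEqFinrank hli hcard) μ hμ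
    fun i => ?_
  simpa using (hv i).apply_eq_smul

/-- The entries of `h(X)` for `t = diag(t, 1, t⁻¹)`. -/
theorem hFull_apply {F : Type*} [Field F] {t : F} (ht : t ≠ 0) (X : Matrix (Fin 3) (Fin 3) F) :
    hFull F t 1 t⁻¹ X =
      !![-X 1 1, -(t * X 0 1), t⁻¹ * X 2 1;
         -(t⁻¹ * X 1 0), -X 0 0, t⁻¹ ^ 2 * X 2 0;
         t * X 1 2, t ^ 2 * X 0 2, -X 2 2] := by
  have hg : nw F * Matrix.diagonal ![t, 1, t⁻¹] = !![0, 1, 0; t, 0, 0; 0, 0, -t⁻¹] := by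
    ext i j
    fin_cases i <;> fin_cases j <;> simp [nw]
  have hinv : (!![0, 1, 0; t, 0, 0; 0, 0, -t⁻¹])⁻¹ = !![0, t⁻¹, 0; 1, 0, 0; 0, 0, -t] := by
    refine Matrix.inv_eq_right_inv ?_
    ext i j
    fin_cases i <;> fin_cases j <;> simp [ht]
  simp only [hFull, hg, hinv]
  ext i j
  fin_cases i <;> fin_cases j <;>
    simp [Matrix.vecMul, dotProduct, Matrix.mul_apply, Fin.sum_univ_three] <;> field_simp

/-- Eigenvectors of `h` on `3 × 3` matrices for `t = diag(s², 1, s⁻²)`. -/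
def hEigenvector {F : Type*} [Field F] (s : F) : Fin 8 → Matrix (Fin 3) (Fin 3) F :=
  ![!![1, 0, 0; 0, -1, 0; 0, 0, 0],
    !![1, 0, 0; 0, 1, 0; 0, 0, -2],
    !![0, 1, 0; 0, 0, 0; 0, 0, 0],
    !![0, 0, 0; 1, 0, 0; 0, 0, 0],
    !![0, 0, 1; 0, 0, 0; 0, s ^ 3, 0],
    !![0, 0, 1; 0, 0, 0; 0, -s ^ 3, 0],
    !![0, 0, 0; 0, 0, 1; s ^ 3, 0, 0],
    !![0, 0, 0; 0, 0, 1; -s ^ 3, 0, 0]]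

theorem hEigenvector_mem_sl3 {F : Type*} [Field F] (s : F) (k : Fin 8) :
    hEigenvector s k ∈ sl3 F := by
  rw [mem_sl3_iff]
  fin_cases k <;> simp [hEigenvector]
  norm_num

theorem hEigenvector_ne_zero {F : Type*} [Field F] (s : F) (k : Fin 8) :
    hEigenvector s k ≠ 0 := by
  intro h
  have hij (i j : Fin 3) : hEigenvector s k i j = 0 := by rw [h]; rfl
  have h00 := hij 0 0
  have h01 := hij 0 1
  have h10 := hij 1 0
  have h02 := hij 0 2
  have h12 := hij 1 2
  fin_cases k <;> simp [hEigenvector] at h00 h01 h10 h02 h12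

theorem hFull_hEigenvector {F : Type*} [Field F] {s : F} (hs : s ≠ 0) (k : Fin 8) :
    hFull F (s ^ 2) 1 (s ^ 2)⁻¹ (hEigenvector s k) =
      (![1, -1, -s ^ 2, -(s ^ 2)⁻¹, s, -s, s⁻¹, -s⁻¹] : Fin 8 → F) k • hEigenvector s k := by
  rw [hFull_apply (pow_ne_zero 2 hs)]
  ext i j
  fin_cases k <;> fin_cases i <;> fin_cases j <;> simp [hEigenvector] <;> field_simp

/-- With `t = diag(t₁, 1, t₁⁻¹)` and `s² = t₁`: if the eight elements
`1, -1, -t₁, -t₁⁻¹, s, -s, s⁻¹, -s⁻¹` are pairwise distinct, then the endomorphism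
`h : X ↦ -((n_w t) X (n_w t)⁻¹)ᵀ` of `sl₃(F)` has simple spectrum. -/
theorem stmt_5 (F : Type*) [Field F] [IsAlgClosed F]
    (hchar2 : (2 : F) ≠ 0) (hchar3 : (3 : F) ≠ 0)
    (t₁ : F) (ht₁ : t₁ ≠ 0) (s : F) (hs : s ^ 2 = t₁)
    (hdistinct : ([1, -1, -t₁, -t₁⁻¹, s, -s, s⁻¹, -s⁻¹] : List F).Nodup)
    (hinv : ∀ X ∈ sl3 F, hFull F t₁ 1 t₁⁻¹ X ∈ sl3 F) :
    HasSimpleSpectrum ((hFull F t₁ 1 t₁⁻¹).restrict hinv) := by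
  subst hs
  have hs : s ≠ 0 := fun h => ht₁ (by simp [h])
  refine hasSimpleSpectrum_of_eigenvectors _
    (![1, -1, -s ^ 2, -(s ^ 2)⁻¹, s, -s, s⁻¹, -s⁻¹] : Fin 8 → F) ?_
    (fun k => ⟨hEigenvector s k, hEigenvector_mem_sl3 s k⟩)
    (fun k => ⟨Module.End.mem_eigenspace_iff.2 (Subtype.ext (hFull_hEigenvector hs k)),
      fun h => hEigenvector_ne_zero s k (congrArg Subtype.val h)⟩)
    (by rw [finrank_sl3, Fintype.card_fin])
  rw [← List.nodup_ofFn]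
  simpa [List.ofFn_succ] using hdistinct
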